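/- Let t ≥ 2 and n ≥ ⌈t/2⌉, and let π be a QU-resolution falsity proof of the mod-3 formula Ψₙ from the axiom set H(Ψₙ, Π_t). Then the label of every sink of G(π) is defined on at least one of the variables x_{n−⌈t/2⌉+1}, y_{n−⌈t/2⌉+1}, …, x_{n−1}, y_{n−1}, xₙ, yₙ. -/

import Mathlib

/-! Framework for quantified Boolean circuits (QBCs), QU-resolution,
relaxations, and the prover–delayer game, following Chen,
"Proof Complexity Modulo the Polynomial Hierarchy". -/

/-- Quantifiers. -/
inductive Quant where
  | all : Quant
  | ex : Quant
deriving DecidableEq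

/-- A partial assignment of Boolean values to (numbered) propositional
variables.  Via the correspondence `C ↔ assign(C)`, partial assignments also
represent clauses (the clause `clause(a)` is the unique clause with variable
set `dom a` falsified by `a`); we freely identify the two. -/
abbrev PA : Type := ℕ → Option Bool

/-- The everywhere-undefined partial assignment (= the empty clause). -/
def emptyPA : PA := fun _ => none

/-- `g` extends the partial assignment `f`. -/
def ExtendsPA (g f : PA) : Prop := ∀ v b, f v = some b → g v = some b

/-- A total assignment `g` extends a partial assignment `f`; when `f`
represents a clause, this says `g` falsifies that clause. -/
def TotalExtends (g : ℕ → Bool) (f : PA) : Prop := ∀ v b, f v = some b → g v = b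

/-- A partial assignment `r` satisfies a clause `C` (i.e. makes some literal
of `C` true). -/
def SatisfiedBy (r : PA) (C : PA) : Prop := ∃ v b, C v = some b ∧ r v = some (!b)

/-- A quantified Boolean circuit: a quantifier prefix (a list of
quantifier/variable pairs) together with a Boolean function on total
assignments, represented as a predicate. -/
structure QBC where
  pfx : List (Quant × ℕ)
  matrix : (ℕ → Bool) → Prop

/-- The variables of the prefix of a QBC. -/
def QBC.vars (Φ : QBC) : List ℕ := Φ.pfx.map Prod.snd

/-- Well-formedness of a QBC: the prefix has no repeated variables, and the
matrix depends only on the values of the prefix variables. -/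
def QBC.WellFormed (Φ : QBC) : Prop :=
  Φ.vars.Nodup ∧
  ∀ f g : ℕ → Bool, (∀ v ∈ Φ.vars, f v = g v) → (Φ.matrix f ↔ Φ.matrix g)

/-- Standard semantics of a quantifier prefix over a matrix, starting from a
base assignment. -/
def evalQ : List (Quant × ℕ) → ((ℕ → Bool) → Prop) → (ℕ → Bool) → Prop
  | [], φ, g => φ g
  | (Quant.ex, v) :: P, φ, g => ∃ b, evalQ P φ (Function.update g v b)
  | (Quant.all, v) :: P, φ, g => ∀ b, evalQ P φ (Function.update g v b)

/-- Truth of a QBC. -/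
def QBC.IsTrue (Φ : QBC) : Prop := ∀ g, evalQ Φ.pfx Φ.matrix g

/-- Falsity of a QBC. -/
def QBC.IsFalse (Φ : QBC) : Prop := ¬ Φ.IsTrue

/-- The existentially quantified variables of a prefix. -/
def existVars (P : List (Quant × ℕ)) : List ℕ :=
  (P.filter fun p => decide (p.1 = Quant.ex)).map Prod.snd

/-- The universally quantified variables of a prefix. -/
def univVars (P : List (Quant × ℕ)) : List ℕ :=
  (P.filter fun p => decide (p.1 = Quant.all)).map Prod.snd

/-- The relation `u ⪯ v` of a prefix: `vᵢ ⪯ vⱼ` iff `i ≤ j`, or `j < i` and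
`Qⱼ = Qⱼ₊₁ = ⋯ = Qᵢ`. -/
def preceq (P : List (Quant × ℕ)) (u v : ℕ) : Prop :=
  ∃ i j : ℕ, (P[i]?).map Prod.snd = some u ∧ (P[j]?).map Prod.snd = some v ∧
    (i ≤ j ∨ (j < i ∧ ∀ k, j ≤ k → k ≤ i → (P[k]?).map Prod.fst = (P[j]?).map Prod.fst))

/-- `u` strictly precedes `v` (`u ⪯ v` and not `v ⪯ u`). -/
def strictPrec (P : List (Quant × ℕ)) (u v : ℕ) : Prop :=
  preceq P u v ∧ ¬ preceq P v u

/-- dom(f) ⪯ y : every variable on which `f` is defined is `⪯ y`. -/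
def domPrec (P : List (Quant × ℕ)) (f : PA) (y : ℕ) : Prop :=
  ∀ u, f u ≠ none → preceq P u y

/-- An ∃-strategy: a family of response functions for the existential
variables, each depending only on the universal variables strictly
preceding it. -/
def IsExStrategy (Φ : QBC) (σ : ℕ → (ℕ → Bool) → Bool) : Prop :=
  ∀ x ∈ existVars Φ.pfx, ∀ τ τ' : ℕ → Bool,
    (∀ y ∈ univVars Φ.pfx, strictPrec Φ.pfx y x → τ y = τ' y) → σ x τ = σ x τ'

/-- The total assignment `⟨σ, τ⟩` induced by an ∃-strategy `σ` and an
assignment `τ` to the universal variables. -/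
def playE (Φ : QBC) (σ : ℕ → (ℕ → Bool) → Bool) (τ : ℕ → Bool) : ℕ → Bool :=
  fun v => if v ∈ existVars Φ.pfx then σ v τ else τ v

/-- `σ` is a winning ∃-strategy of the prefix of `Φ` for the matrix `M`. -/
def ModelOf (Φ : QBC) (M : (ℕ → Bool) → Prop) (σ : ℕ → (ℕ → Bool) → Bool) : Prop :=
  IsExStrategy Φ σ ∧ ∀ τ : ℕ → Bool, M (playE Φ σ τ)

/-- A model of `Φ` (a winning ∃-strategy). -/
def QBC.Model (Φ : QBC) (σ : ℕ → (ℕ → Bool) → Bool) : Prop :=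
  ModelOf Φ Φ.matrix σ

/-- `σ` is a model of `P : C`, where `P` is the prefix of `Φ` and `C` is a
clause (represented by its falsifying assignment). -/
def ModelOfClause (Φ : QBC) (σ : ℕ → (ℕ → Bool) → Bool) (C : PA) : Prop :=
  ModelOf Φ (fun g => ¬ TotalExtends g C) σ

/-- `C` is an axiom of `Φ`: a clause on the variables of `Φ` such that every
model of `Φ` is a model of `P : C`. -/
def IsAxiom (Φ : QBC) (C : PA) : Prop :=
  (∀ v, C v ≠ none → v ∈ Φ.vars) ∧ ∀ σ, Φ.Model σ → ModelOfClause Φ σ C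

/-- An axiom set of `Φ`. -/
def IsAxiomSet (Φ : QBC) (H : Set PA) : Prop := ∀ C ∈ H, IsAxiom Φ C

/-- A ∀-strategy: response functions for the universal variables, each
depending only on the existential variables strictly preceding it. -/
def IsUnivStrategy (Φ : QBC) (τ : ℕ → (ℕ → Bool) → Bool) : Prop :=
  ∀ y ∈ univVars Φ.pfx, ∀ σ σ' : ℕ → Bool,
    (∀ x ∈ existVars Φ.pfx, strictPrec Φ.pfx x y → σ x = σ' x) → τ y σ = τ y σ'

/-- The total assignment `⟨τ, σ⟩` induced by a ∀-strategy `τ` and an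
assignment `σ` to the existential variables. -/
def playU (Φ : QBC) (τ : ℕ → (ℕ → Bool) → Bool) (σ : ℕ → Bool) : ℕ → Bool :=
  fun v => if v ∈ univVars Φ.pfx then τ v σ else σ v

/-- A winning ∀-strategy: every play falsifies the matrix. -/
def WinningUnivStrategy (Φ : QBC) (τ : ℕ → (ℕ → Bool) → Bool) : Prop :=
  IsUnivStrategy Φ τ ∧ ∀ σ : ℕ → Bool, ¬ Φ.matrix (playU Φ τ σ)

/-- `C` is obtainable from `D` by ∀-elimination (relative to prefix `P`):
`C = D ∖ {L}` for a literal `L` on a universal variable `y` with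
`vars(C) ⪯ y`.  In assignment form: `D` is `C` additionally defined on `y`. -/
def ForallElim (P : List (Quant × ℕ)) (C D : PA) : Prop :=
  ∃ y b, y ∈ univVars P ∧ C y = none ∧ D = Function.update C y (some b) ∧
    ∀ u, C u ≠ none → preceq P u y

/-- `γ` is the resolvent of `α` and `β` on variable `v` (in falsifying
assignment form: `α` and `β` carry complementary literals on `v`, `γ` is
the union of the remainders, which must be a clause). -/
def IsResolvent (γ α β : PA) (v : ℕ) : Prop :=
  ∃ b, α v = some b ∧ β v = some (!b) ∧ γ v = none ∧
    (∀ u, u ≠ v → γ u = (α u).elim (β u) some) ∧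
    (∀ u, u ≠ v → ∀ b₁ b₂, α u = some b₁ → β u = some b₂ → b₁ = b₂)

/-- A step in a QU-resolution proof: an axiom, a ∀-elimination (annotated with
the index of its source), or a resolution step (annotated with the indices of
its two sources and the resolved variable). -/
inductive QUStep where
  | ax (C : PA)
  | elim (C : PA) (src : ℕ)
  | res (C : PA) (src₁ src₂ : ℕ) (v : ℕ)

/-- The clause of a proof step. -/
def QUStep.clause : QUStep → PA
  | .ax C => C
  | .elim C _ => C
  | .res C _ _ _ => C

/-- The clause at position `i` of a proof. -/
def stepClause? (L : List QUStep) (i : ℕ) : Option PA := (L[i]?).map QUStep.clause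

/-- Validity of the `i`-th step of a proof from axiom set `H`. -/
def validStep (P : List (Quant × ℕ)) (H : Set PA) (L : List QUStep) (i : ℕ) : Prop :=
  match L[i]? with
  | none => True
  | some (.ax C) => C ∈ H
  | some (.elim C j) => j < i ∧ ∃ D, stepClause? L j = some D ∧ ForallElim P C D
  | some (.res C j k v) => j < i ∧ k < i ∧
      ∃ α β, stepClause? L j = some α ∧ stepClause? L k = some β ∧ IsResolvent C α β v

/-- A QU-resolution proof of `Φ` from axiom set `H`. -/
def IsQUProof (Φ : QBC) (H : Set PA) (L : List QUStep) : Prop :=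
  ∀ i, validStep Φ.pfx H L i

/-- A QU-resolution falsity proof: a proof ending with the empty clause. -/
def IsFalsityProof (Φ : QBC) (H : Set PA) (L : List QUStep) : Prop :=
  IsQUProof Φ H L ∧ (L.getLast?).map QUStep.clause = some emptyPA

/-- The clause `C` appears in the proof `L`. -/
def AppearsIn (L : List QUStep) (C : PA) : Prop := ∃ i, stepClause? L i = some C

/-- The edge relation of the graph `G(π)`: an edge from each clause occurrence
to the clause occurrence(s) from which it is derived. -/
def edge (L : List QUStep) (i j : ℕ) : Prop :=
  match L[i]? with
  | some (.elim _ s) => j = s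
  | some (.res _ s t _) => j = s ∨ j = t
  | _ => False

/-- A sink (leaf) of `G(π)`: a vertex with no outgoing edges. -/
def isSink (L : List QUStep) (i : ℕ) : Prop := i < L.length ∧ ∀ j, ¬ edge L i j

/-- The proof is tree-like: `G(π)` is a tree (each vertex has at most one
incoming edge; acyclicity holds automatically since edges decrease indices). -/
def TreeLike (L : List QUStep) : Prop := ∀ j : ℕ, {i | edge L i j}.Subsingleton

-- The prefix `P[a]`: the variables of `dom a` are removed, and the
-- quantifier of every variable strictly preceding some variable of `dom a`
-- (equivalently, every `v` with `v ⪯ last(a)` and not `last(a) ⪯ v`) is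
-- changed to `∃`.
open Classical in
noncomputable def instPrefix (P : List (Quant × ℕ)) (a : PA) : List (Quant × ℕ) :=
  (P.filter fun p => (a p.2).isNone).map fun p =>
    (if ∃ u, a u ≠ none ∧ strictPrec P p.2 u then Quant.ex else p.1, p.2)

/-- Overriding a total assignment by a partial assignment. -/
def override (a : PA) (g : ℕ → Bool) : ℕ → Bool := fun v => (a v).getD (g v)

/-- The instantiated QBC `Φ[a]` = `P[a] : φ[a]`. -/
noncomputable def QBC.inst (Φ : QBC) (a : PA) : QBC :=
  ⟨instPrefix Φ.pfx a, fun g => Φ.matrix (override a g)⟩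

/-- `P'` is a relaxation of the prefix `P`: a permutation of `P` such that
`y ⪯ x` implies `y ⪯' x` for every universal `y` and existential `x`. -/
def IsRelaxationPfx (P P' : List (Quant × ℕ)) : Prop :=
  P.Perm P' ∧ ∀ y ∈ univVars P, ∀ x ∈ existVars P, preceq P y x → preceq P' y x

/-- `Φ'` is a relaxation of the QBC `Φ`. -/
def IsRelaxation (Φ Φ' : QBC) : Prop :=
  IsRelaxationPfx Φ.pfx Φ'.pfx ∧ Φ'.matrix = Φ.matrix

/-- Negation of a quantifier. -/
def Quant.neg : Quant → Quant
  | .all => .ex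
  | .ex => .all

/-- `isAltFrom q i qs`: the quantifier string `qs` consists of (at most) `i`
alternating possibly-empty blocks, starting with a block of `q`s. -/
def isAltFrom : Quant → ℕ → List Quant → Prop
  | _, 0, qs => qs = []
  | q, i + 1, qs => ∃ k rest, qs = List.replicate k q ++ rest ∧ isAltFrom q.neg i rest

/-- The prefix `P` is `Π_i`: its quantifier string lies in `∀*∃*∀*⋯` with `i`
alternating starred blocks beginning with `∀*`. -/
def isPiPrefix (i : ℕ) (P : List (Quant × ℕ)) : Prop :=
  isAltFrom Quant.all i (P.map Prod.fst)

/-- The axiom set `H(Φ, Π_k)`: the clauses `C` on variables of `Φ` such that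
some `Π_k`-relaxation of `Φ[assign(C)]` is false. -/
def Hset (Φ : QBC) (k : ℕ) : Set PA :=
  {C | (∀ v, C v ≠ none → v ∈ Φ.vars) ∧
    ∃ Φ' : QBC, IsRelaxation (Φ.inst C) Φ' ∧ isPiPrefix k Φ'.pfx ∧ Φ'.IsFalse}

/-- `g` is a semicompletion of `f` (relative to prefix `P`). -/
def SemiComp (P : List (Quant × ℕ)) (f g : PA) : Prop :=
  ExtendsPA g f ∧
  ∀ y ∈ univVars P, f y = none → domPrec P f y → (g y = none ∧ domPrec P g y)

/-- A set of partial assignments of `Φ` is semicompletion-closed. -/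
def SemiCompClosed (Φ : QBC) (H : Set PA) : Prop :=
  ∀ f ∈ H, ∀ g : PA, (∀ v, g v ≠ none → v ∈ Φ.vars) → SemiComp Φ.pfx f g → g ∈ H

/-- Delayer condition (semicompletion-of-empty). -/
def CondEmpty (Φ : QBC) (F : Set PA) (s : PA → ℕ) : Prop :=
  ∃ g ∈ F, SemiComp Φ.pfx emptyPA g ∧ s g = 0

/-- Delayer condition (monotonicity). -/
def CondMono (Φ : QBC) (F : Set PA) (s : PA → ℕ) : Prop :=
  ∀ g ∈ F, ∀ f' : PA, ExtendsPA g f' → ∃ f ∈ F, SemiComp Φ.pfx f' f ∧ s f ≤ s g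

/-- Delayer condition (∀-branching). -/
def CondForallB (Φ : QBC) (F : Set PA) (s : PA → ℕ) : Prop :=
  ∀ f ∈ F, ∀ y ∈ univVars Φ.pfx, f y = none → domPrec Φ.pfx f y →
    ∀ b : Bool, ∃ g ∈ F, SemiComp Φ.pfx (Function.update f y (some b)) g ∧ s g = s f

/-- Delayer condition (double-branching). -/
def CondDoubleB (Φ : QBC) (F : Set PA) (s : PA → ℕ) : Prop :=
  ∀ f ∈ F, ∀ v ∈ Φ.vars, f v = none →
    ∃ b : Bool, ∃ g ∈ F, SemiComp Φ.pfx (Function.update f v (some b)) g ∧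
      s g ≤ s f + 1 ∧
      (s g = s f + 1 →
        ∃ g' ∈ F, SemiComp Φ.pfx (Function.update f v (some (!b))) g' ∧ s g' ≤ s f + 1)

/-- A `p`-point delayer strategy for `Φ` with respect to axiom set `H`. -/
def IsDelayer (Φ : QBC) (H : Set PA) (p : ℕ) (F : Set PA) (s : PA → ℕ) : Prop :=
  (∀ f ∈ F, ∀ v, f v ≠ none → v ∈ Φ.vars) ∧
  CondEmpty Φ F s ∧ (∀ f ∈ F, f ∈ H → p ≤ s f) ∧
  CondMono Φ F s ∧ CondForallB Φ F s ∧ CondDoubleB Φ F s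

/-! The separation formulas `Φₙ` of Section 6. -/

/-- The variable `x_{i,j,k}`. -/
def xV (i : ℕ) (j k : Bool) : ℕ := 9 * i + 2 * cond j 1 0 + cond k 1 0

/-- The variable `x'_{i,j,k}`. -/
def xV' (i : ℕ) (j k : Bool) : ℕ := 9 * i + 4 + 2 * cond j 1 0 + cond k 1 0

/-- The variable `yᵢ`. -/
def yV (i : ℕ) : ℕ := 9 * i + 8

/-- A block of four quantified variables. -/
def blockOf (q : Quant) (f : Bool → Bool → ℕ) : List (Quant × ℕ) :=
  [(q, f false false), (q, f false true), (q, f true false), (q, f true true)]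

/-- The prefix `∃X₀ ∃X'₁∀y₁∃X₁ ⋯ ∃X'ₙ∀yₙ∃Xₙ`. -/
def sepPrefix (n : ℕ) : List (Quant × ℕ) :=
  blockOf Quant.ex (xV 0) ++
    (List.range n).flatMap fun i =>
      blockOf Quant.ex (xV' (i + 1)) ++ [(Quant.all, yV (i + 1))] ++
        blockOf Quant.ex (xV (i + 1))

/-- The clause `¬x_{0,j,k}` (as its falsifying assignment). -/
def clB1 (j k : Bool) : PA := fun v => if v = xV 0 j k then some true else none

/-- The clause `x_{n,j,0} ∨ x_{n,j,1}`. -/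
def clB2 (n : ℕ) (j : Bool) : PA :=
  fun v => if v = xV n j false ∨ v = xV n j true then some false else none

/-- The clause `¬x'_{i,0,k} ∨ ¬x'_{i,1,l} ∨ x_{i−1,j,0} ∨ x_{i−1,j,1}`. -/
def clH (i : ℕ) (j k l : Bool) : PA := fun v =>
  if v = xV' i false k ∨ v = xV' i true l then some true
  else if v = xV (i - 1) j false ∨ v = xV (i - 1) j true then some false
  else none

/-- For `j = false` the clause `¬x_{i,0,k} ∨ yᵢ ∨ x'_{i,0,k}`; for `j = true`
the clause `¬x_{i,1,k} ∨ ¬yᵢ ∨ x'_{i,1,k}`. -/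
def clT (i : ℕ) (j k : Bool) : PA := fun v =>
  if v = xV i j k then some true
  else if v = yV i then some j
  else if v = xV' i j k then some false
  else none

/-- The set `Tᵢ` of clauses. -/
def Tset (i : ℕ) : Set PA := {C | ∃ j k : Bool, C = clT i j k}

/-- The set of clauses of the matrix `φₙ`. -/
def sepClauses (n : ℕ) : Set PA :=
  {C | (∃ j k : Bool, C = clB1 j k) ∨ (∃ j : Bool, C = clB2 n j) ∨
    (∃ i, 1 ≤ i ∧ i ≤ n ∧ ∃ j k l : Bool, C = clH i j k l) ∨
    (∃ i, 1 ≤ i ∧ i ≤ n ∧ ∃ j k : Bool, C = clT i j k)}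

/-- The separation formula `Φₙ`. -/
def sepQBC (n : ℕ) : QBC :=
  ⟨sepPrefix n, fun g => ∀ C ∈ sepClauses n, ¬ TotalExtends g C⟩

/-- The level-`i` variables `X'ᵢ ∪ {yᵢ} ∪ Xᵢ`. -/
def levelVars (i : ℕ) : List ℕ :=
  [xV' i false false, xV' i false true, xV' i true false, xV' i true true, yV i,
   xV i false false, xV i false true, xV i true false, xV i true true]

/-- `r` is defined exactly on the level-`i` variables. -/
def OnLevel (i : ℕ) (r : PA) : Prop := ∀ v, r v ≠ none ↔ v ∈ levelVars i

/-- A normal realization of level `i`. -/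
def NormalReal (i : ℕ) (r : PA) : Prop :=
  OnLevel i r ∧ ∃ b : Bool, r (yV i) = some b ∧
    r (xV i b false) = some false ∧ r (xV' i b false) = some false ∧
    r (xV i b true) = some false ∧ r (xV' i b true) = some false ∧
    ∃ c : Bool, r (xV i (!b) false) = some c ∧ r (xV' i (!b) false) = some c ∧
      r (xV i (!b) true) = some (!c) ∧ r (xV' i (!b) true) = some (!c)

/-- A funny realization of level `i`. -/
def FunnyReal (i : ℕ) (r : PA) : Prop :=
  OnLevel i r ∧ ∃ b : Bool, r (yV i) = some b ∧
    (∃ c : Bool, r (xV i b false) = some c ∧ r (xV' i b false) = some c ∧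
      r (xV i b true) = some (!c) ∧ r (xV' i b true) = some (!c)) ∧
    r (xV' i (!b) false) = some false ∧ r (xV' i (!b) true) = some false ∧
    ∃ d : Bool, r (xV i (!b) false) = some d ∧ r (xV i (!b) true) = some (!d)

/-- Restriction of a partial assignment to the level-`i` variables. -/
def restrictLevel (i : ℕ) (f : PA) : PA :=
  fun v => if v ∈ levelVars i then f v else none

-- The maximum level `ℓ` containing an existentially quantified variable of
-- `dom f` (and `0` if there is none).
open Classical in
noncomputable def maxLevel (n : ℕ) (f : PA) : ℕ :=
  ((Finset.Icc 1 n).filter fun i => ∃ v ∈ levelVars i, v ≠ yV i ∧ f v ≠ none).sup id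

/-- `f` is half-defined on level `ℓ`. -/
def HalfDefined (ℓ : ℕ) (f : PA) : Prop :=
  (∀ j k : Bool, f (xV ℓ j k) = none) ∧
  (∃ j k : Bool, f (xV' ℓ j k) = some true ∧
    ∀ j' k' : Bool, (j', k') ≠ (j, k) → f (xV' ℓ j' k') = some false)

/-- A normal assignment of `Φₙ`. -/
def NormalAssign (n : ℕ) (f : PA) : Prop :=
  (∀ v, f v ≠ none → v ∈ (sepPrefix n).map Prod.snd) ∧
  (∀ j k : Bool, f (xV 0 j k) = some false) ∧
  (∀ i, 1 ≤ i → i + 1 ≤ maxLevel n f → NormalReal i (restrictLevel i f)) ∧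
  (1 ≤ maxLevel n f →
    (NormalReal (maxLevel n f) (restrictLevel (maxLevel n f) f) ∨
      HalfDefined (maxLevel n f) f))

/-- A funny assignment of `Φₙ`, with witness `m` (so that `sₙ(f) = m`). -/
def FunnyAssign (n : ℕ) (f : PA) (m : ℕ) : Prop :=
  (∀ v, f v ≠ none → v ∈ (sepPrefix n).map Prod.snd) ∧
  1 ≤ m ∧ m ≤ maxLevel n f ∧
  (∀ j k : Bool, f (xV 0 j k) = some false) ∧
  (∀ i, 1 ≤ i → i < m → NormalReal i (restrictLevel i f)) ∧
  FunnyReal m (restrictLevel m f) ∧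
  (∀ i, m < i → i ≤ maxLevel n f → ∀ j : Bool,
    ((f (xV i j false) ≠ none ∨ f (xV i j true) ≠ none ∨
      f (xV' i j false) ≠ none ∨ f (xV' i j true) ≠ none) →
      ∃ c : Bool, f (xV i j false) = some c ∧ f (xV' i j false) = some c ∧
        f (xV i j true) = some (!c) ∧ f (xV' i j true) = some (!c)))

/-- The set `Fₙ` of normal and funny assignments. -/
def Fset (n : ℕ) : Set PA := {f | NormalAssign n f ∨ ∃ m, FunnyAssign n f m}

-- The score function `sₙ`.
open Classical in
noncomputable def score (n : ℕ) (f : PA) : ℕ :=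
  if h : ∃ m, FunnyAssign n f m then h.choose else maxLevel n f

/-! The mod-3 formulas `Ψₙ` of Section 7 (variables `xᵢ = 2i`, `yᵢ = 2i+1`). -/

/-- The prefix `∃x₁∀y₁⋯∃xₙ∀yₙ`. -/
def modPrefix (n : ℕ) : List (Quant × ℕ) :=
  (List.range n).flatMap fun i =>
    [(Quant.ex, 2 * (i + 1)), (Quant.all, 2 * (i + 1) + 1)]

/-- Numeric value of a Boolean. -/
def boolVal (b : Bool) : ℕ := cond b 1 0

/-- The matrix `φ_{n,j}`: true iff `j + Σᵢ (xᵢ + yᵢ) ≢ n (mod 3)`. -/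
def modMatrix (n j : ℕ) (g : ℕ → Bool) : Prop :=
  ¬ ((j + ∑ i ∈ Finset.Icc 1 n, (boolVal (g (2 * i)) + boolVal (g (2 * i + 1)))) % 3
      = n % 3)

/-- The mod-3 formula `Ψₙ`. -/
def modQBC (n : ℕ) : QBC := ⟨modPrefix n, modMatrix n 0⟩

theorem mem_univVars_iff (P : List (Quant × ℕ)) (v : ℕ) :
    v ∈ univVars P ↔ (Quant.all, v) ∈ P := by
  unfold univVars
  simp

theorem mem_existVars_iff (P : List (Quant × ℕ)) (v : ℕ) :
    v ∈ existVars P ↔ (Quant.ex, v) ∈ P := by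
  unfold existVars
  simp

/-- A (sequential) winning strategy for the existential player gives truth. -/
theorem evalQ_of_strat (f : ℕ → (ℕ → Bool) → Bool) (M : (ℕ → Bool) → Prop) :
    ∀ (P : List (Quant × ℕ)) (g0 : ℕ → Bool), (P.map Prod.snd).Nodup →
      (∀ P1 x P2, P = P1 ++ (Quant.ex, x) :: P2 → ∀ g g' : ℕ → Bool,
        (∀ v, v ∉ x :: P2.map Prod.snd → g v = g' v) → f x g = f x g') →
      (∀ g : ℕ → Bool, (∀ v, v ∉ P.map Prod.snd → g v = g0 v) →
        (∀ x, (Quant.ex, x) ∈ P → g x = f x g) → M g) →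
      evalQ P M g0 := by
  intro P
  induction P with
  | nil =>
    intro g0 _ _ h
    exact h g0 (fun _ _ => rfl) (by simp)
  | cons p P ih =>
    intro g0 hnd hdep hM
    obtain ⟨q, v⟩ := p
    have hnd' : v ∉ P.map Prod.snd ∧ (P.map Prod.snd).Nodup := by
      simpa only [List.map_cons, List.nodup_cons] using hnd
    have hdep' : ∀ P1 x P2, P = P1 ++ (Quant.ex, x) :: P2 → ∀ g g' : ℕ → Bool,
        (∀ v, v ∉ x :: P2.map Prod.snd → g v = g' v) → f x g = f x g' := by
      intro P1 x P2 h
      exact hdep ((q, v) :: P1) x P2 (by rw [h]; rfl)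
    have agree : ∀ (b : Bool) (g : ℕ → Bool),
        (∀ w, w ∉ P.map Prod.snd → g w = Function.update g0 v b w) →
        g v = b ∧ ∀ w, w ∉ v :: P.map Prod.snd → g w = g0 w := by
      intro b g hg
      refine ⟨by rw [hg v hnd'.1]; simp, ?_⟩
      intro w hw
      rw [List.mem_cons, not_or] at hw
      rw [hg w hw.2, Function.update_of_ne hw.1]
    cases q with
    | ex =>
      refine ⟨f v g0, ih _ hnd'.2 hdep' ?_⟩
      intro g hg hx
      obtain ⟨h1, h2⟩ := agree _ g hg
      refine hM g (by simpa only [List.map_cons] using h2) ?_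
      intro x hxm
      rcases List.mem_cons.1 hxm with h | h
      · have : x = v := by simpa using h
        subst this
        rw [h1]
        exact (hdep [] x P rfl g g0 h2).symm
      · exact hx x h
    | all =>
      intro b
      refine ih _ hnd'.2 hdep' ?_
      intro g hg hx
      obtain ⟨h1, h2⟩ := agree _ g hg
      refine hM g (by simpa only [List.map_cons] using h2) ?_
      intro x hxm
      rcases List.mem_cons.1 hxm with h | h
      · simp at h
      · exact hx x h

/-- Positions are determined by variables. -/
theorem pos_unique {P : List (Quant × ℕ)} (hnd : (P.map Prod.snd).Nodup) {i j : ℕ} {u : ℕ}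
    (hi : (P[i]?).map Prod.snd = some u) (hj : (P[j]?).map Prod.snd = some u) : i = j := by
  rw [← List.getElem?_map] at hi hj
  have hi' : i < (P.map Prod.snd).length := by
    by_contra h
    rw [List.getElem?_eq_none (by omega)] at hi
    simp at hi
  exact (List.getElem?_inj hi' hnd).1 (hi.trans hj.symm)

/-- For universal `y` and existential `x`, `y ⪯ x` means `y` is positioned before `x`. -/
theorem preceq_pos {P : List (Quant × ℕ)} (hnd : (P.map Prod.snd).Nodup) {i j : ℕ} {y x : ℕ}
    (hi : P[i]? = some (Quant.all, y)) (hj : P[j]? = some (Quant.ex, x)) :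
    preceq P y x ↔ i < j := by
  constructor
  · rintro ⟨i', j', hi', hj', h⟩
    have e1 : i' = i := pos_unique hnd hi' (by rw [hi]; rfl)
    have e2 : j' = j := pos_unique hnd hj' (by rw [hj]; rfl)
    subst e1 e2
    rcases h with h | ⟨h, hq⟩
    · rcases Nat.lt_or_ge i' j' with h' | h'
      · exact h'
      · have : i' = j' := by omega
        subst this
        rw [hi] at hj
        simp at hj
    · have := hq i' h.le le_rfl
      rw [hi, hj] at this
      simp at this
  · intro h
    exact ⟨i, j, by rw [hi]; rfl, by rw [hj]; rfl, Or.inl h.le⟩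

theorem not_mem_tail_of_preceq {P P1 P2 : List (Quant × ℕ)} {x y : ℕ}
    (hnd : (P.map Prod.snd).Nodup) (hP : P = P1 ++ (Quant.ex, x) :: P2)
    (hy : (Quant.all, y) ∈ P) (h : preceq P y x) : y ∉ x :: P2.map Prod.snd := by
  obtain ⟨i, hi⟩ := List.mem_iff_getElem?.1 hy
  have hj : P[P1.length]? = some (Quant.ex, x) := by
    rw [hP]; simp
  have hlt := (preceq_pos hnd hi hj).1 h
  intro hmem
  have : y ∈ ((Quant.ex, x) :: P2).map Prod.snd := by simpa using hmem
  obtain ⟨k, hk⟩ := List.mem_iff_getElem?.1 this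
  have hk' : (P[P1.length + k]?).map Prod.snd = some y := by
    rw [hP, List.getElem?_append_right (by omega), ← List.getElem?_map]
    simpa using hk
  have := pos_unique hnd hk' (j := i) (by rw [hi]; rfl)
  omega

/-- Block numbering of an alternating string. -/
theorem alt_blocks : ∀ (t : ℕ) (q : Quant) (qs : List Quant), isAltFrom q t qs →
    ∃ β : ℕ → ℕ, Monotone β ∧ ∀ k r, qs[k]? = some r →
      β k < t ∧ (r = q ↔ β k % 2 = 0) := by
  intro t
  induction t with
  | zero =>
    intro q qs h
    have h' : qs = [] := h
    subst h'
    exact ⟨fun _ => 0, fun _ _ _ => le_rfl, by simp⟩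
  | succ t ih =>
    rintro q qs ⟨K, rest, hqs, hrest⟩
    obtain ⟨β, hmono, hβ⟩ := ih _ _ hrest
    refine ⟨fun k => if k < K then 0 else β (k - K) + 1, ?_, ?_⟩
    · intro a b hab
      dsimp only
      split_ifs with h1 h2
      · exact le_rfl
      · exact Nat.zero_le _
      · omega
      · exact Nat.succ_le_succ (hmono (by omega))
    · intro k r hk
      rw [hqs] at hk
      dsimp only
      split_ifs with h
      · rw [List.getElem?_append_left (by simpa using h)] at hk
        rw [List.getElem?_replicate] at hk
        simp [h] at hk
        simp [hk]
      · rw [List.getElem?_append_right (by simpa using h)] at hk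
        rw [List.length_replicate] at hk
        obtain ⟨h1, h2⟩ := hβ _ _ hk
        refine ⟨by omega, ?_⟩
        have : r = q ↔ ¬ (r = q.neg) := by
          cases r <;> cases q <;> simp [Quant.neg]
        rw [this, h2]
        omega

/-- Quantifier of variable `v` in the mod-3 prefix. -/
def mq (v : ℕ) : Quant := if v % 2 = 0 then Quant.ex else Quant.all

theorem modPrefix_eq (n : ℕ) :
    modPrefix n = (List.range (2 * n)).map fun i => (mq i, i + 2) := by
  induction n with
  | zero => rfl
  | succ n ih =>
    have h1 : modPrefix (n + 1) = modPrefix n ++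
        [(Quant.ex, 2 * (n + 1)), (Quant.all, 2 * (n + 1) + 1)] := by
      unfold modPrefix
      rw [List.range_succ, List.flatMap_append]
      simp
    have e : 2 * (n + 1) = 2 * n + 1 + 1 := by ring
    rw [h1, ih, e, List.range_succ, List.range_succ]
    simp [mq]

theorem mem_modPrefix (n : ℕ) (q : Quant) (v : ℕ) :
    (q, v) ∈ modPrefix n ↔ 2 ≤ v ∧ v ≤ 2 * n + 1 ∧ q = mq v := by
  rw [modPrefix_eq]
  simp only [List.mem_map, List.mem_range, Prod.mk.injEq]
  constructor
  · rintro ⟨i, h, rfl, rfl⟩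
    refine ⟨by omega, by omega, by simp [mq]⟩
  · rintro ⟨h1, h2, rfl⟩
    refine ⟨v - 2, by omega, ?_, by omega⟩
    unfold mq
    have : (v - 2) % 2 = v % 2 := by omega
    rw [this]

theorem modPrefix_get (n i : ℕ) (h : i < 2 * n) :
    (modPrefix n)[i]? = some (mq i, i + 2) := by
  rw [modPrefix_eq]
  simp [h]

theorem modPrefix_pos {n i u : ℕ} (h : ((modPrefix n)[i]?).map Prod.snd = some u) :
    i < 2 * n ∧ u = i + 2 := by
  have hi : i < 2 * n := by
    by_contra hc
    rw [modPrefix_eq, List.getElem?_eq_none (by simpa using hc)] at h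
    simp at h
  rw [modPrefix_get n i hi] at h
  refine ⟨hi, ?_⟩
  simpa [eq_comm] using h

/-- A universal variable does not precede earlier variables. -/
theorem not_preceq_mod {n m u : ℕ} (hu : u < 2 * m) :
    ¬ preceq (modPrefix n) (2 * m + 1) u := by
  rintro ⟨i, j, hi, hj, h⟩
  obtain ⟨hi1, hi2⟩ := modPrefix_pos hi
  obtain ⟨hj1, hj2⟩ := modPrefix_pos hj
  rcases h with h | ⟨h, hq⟩
  · omega
  · have h1 := hq i h.le le_rfl
    have h2 := hq (i - 1) (by omega) (by omega)
    rw [← h2, modPrefix_get n i hi1, modPrefix_get n (i - 1) (by omega)] at h1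
    have : i % 2 = 1 := by omega
    have h3 : (i - 1) % 2 = 0 := by omega
    simp [mq, this, h3] at h1

theorem sorted_preceq {P : List (Quant × ℕ)} (hs : (P.map Prod.snd).Pairwise (· < ·)) {u v : ℕ}
    (hu : u ∈ P.map Prod.snd) (hv : v ∈ P.map Prod.snd) (h : u < v) : preceq P u v := by
  obtain ⟨i, hi, rfl⟩ := List.mem_iff_getElem.1 hu
  obtain ⟨j, hj, rfl⟩ := List.mem_iff_getElem.1 hv
  have hij : i < j := by
    by_contra hc
    rcases Nat.lt_or_ge j i with h' | h'
    · have := List.pairwise_iff_getElem.1 hs j i hj hi h'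
      omega
    · have : i = j := by omega
      subst this
      omega
  refine ⟨i, j, ?_, ?_, Or.inl hij.le⟩
  · rw [← List.getElem?_map, List.getElem?_eq_getElem hi]
  · rw [← List.getElem?_map, List.getElem?_eq_getElem hj]

theorem instPrefix_sorted (n : ℕ) (a : PA) :
    ((instPrefix (modPrefix n) a).map Prod.snd).Pairwise (· < ·) := by
  have h0 : ((modPrefix n).map Prod.snd).Pairwise (· < ·) := by
    rw [modPrefix_eq, List.map_map, List.pairwise_map]
    refine List.pairwise_lt_range.imp ?_
    intro a b hab
    simpa using hab
  have : ((instPrefix (modPrefix n) a).map Prod.snd).Sublist ((modPrefix n).map Prod.snd) := by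
    unfold instPrefix
    rw [List.map_map]
    exact List.Sublist.map _ List.filter_sublist
  exact h0.sublist this

open Classical in
theorem mem_instPrefix (P : List (Quant × ℕ)) (a : PA) (q : Quant) (v : ℕ) :
    (q, v) ∈ instPrefix P a ↔ a v = none ∧ ∃ q', (q', v) ∈ P ∧
      q = if ∃ u, a u ≠ none ∧ strictPrec P v u then Quant.ex else q' := by
  unfold instPrefix
  simp only [List.mem_map, List.mem_filter, Prod.mk.injEq, Option.isNone_iff_eq_none, Prod.exists]
  constructor
  · rintro ⟨q', v', ⟨h1, h2⟩, h3, rfl⟩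
    exact ⟨h2, q', h1, h3.symm⟩
  · rintro ⟨h1, q', h2, h3⟩
    exact ⟨q', v, ⟨h2, h1⟩, h3.symm, rfl⟩

/-- The response at a level, given the running sum and the value of `y`. -/
def resp (M m s : ℕ) (y : Bool) : Bool :=
  if m < M then false
  else if m = M then decide ((s + boolVal y) % 3 = m % 3)
  else decide (s % 3 = m % 3)

open Classical in
/-- Value of `y_m`, existential ones being set to false. -/
noncomputable def Yv (E : ℕ → Prop) (a : PA) (g : ℕ → Bool) (m : ℕ) : Bool :=
  if E (2 * m + 1) then false else (a (2 * m + 1)).getD (g (2 * m + 1))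

/-- Running sum of the play. -/
noncomputable def Sv (E : ℕ → Prop) (a : PA) (M : ℕ) (g : ℕ → Bool) : ℕ → ℕ
  | 0 => 0
  | k + 1 => Sv E a M g k +
      (boolVal ((a (2 * (k + 1))).getD (resp M (k + 1) (Sv E a M g k) (Yv E a g (k + 1)))) +
        boolVal (Yv E a g (k + 1)))

/-- The strategy. -/
noncomputable def strat (E : ℕ → Prop) (a : PA) (M : ℕ) (v : ℕ) (g : ℕ → Bool) : Bool :=
  if v % 2 = 0 then resp M (v / 2) (Sv E a M g (v / 2 - 1)) (Yv E a g (v / 2)) else false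

theorem Yv_congr {E : ℕ → Prop} {a : PA} {g g' : ℕ → Bool} {m : ℕ}
    (h : ¬ E (2 * m + 1) → a (2 * m + 1) = none → g (2 * m + 1) = g' (2 * m + 1)) :
    Yv E a g m = Yv E a g' m := by
  unfold Yv
  split_ifs with hE
  · rfl
  · cases ha : a (2 * m + 1) with
    | none => simpa using h hE ha
    | some b => rfl

theorem Sv_congr {E : ℕ → Prop} {a : PA} {M : ℕ} {g g' : ℕ → Bool} : ∀ {k : ℕ},
    (∀ m, 1 ≤ m → m ≤ k → ¬ E (2 * m + 1) → a (2 * m + 1) = none →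
      g (2 * m + 1) = g' (2 * m + 1)) →
    Sv E a M g k = Sv E a M g' k := by
  intro k
  induction k with
  | zero => intro _; rfl
  | succ k ih =>
    intro h
    have h1 := ih (fun m h1 h2 => h m h1 (by omega))
    have h2 : Yv E a g (k + 1) = Yv E a g' (k + 1) := Yv_congr (h (k + 1) (by omega) le_rfl)
    simp only [Sv, h1, h2]

theorem resp_lt {M m s : ℕ} {y : Bool} (h : m < M) : resp M m s y = false := by
  simp [resp, h]

theorem resp_gt {M m s : ℕ} {y : Bool} (h : M < m) :
    resp M m s y = decide (s % 3 = m % 3) := by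
  have h1 : ¬ m < M := by omega
  have h2 : m ≠ M := by omega
  simp [resp, h1, h2]

theorem resp_eq {M s : ℕ} {y : Bool} :
    resp M M s y = decide ((s + boolVal y) % 3 = M % 3) := by
  simp [resp]

/-- The strategy wins. -/
theorem Sv_ne {E : ℕ → Prop} {a : PA} {M : ℕ} {g : ℕ → Bool} (hM : 1 ≤ M) : ∀ {k : ℕ},
    M ≤ k → (∀ m, M ≤ m → m ≤ k → a (2 * m) = none) → Sv E a M g k % 3 ≠ k % 3 := by
  intro k
  induction k with
  | zero => intro h; omega
  | succ k ih =>
    intro hk ha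
    have hn := ha (k + 1) hk le_rfl
    simp only [Sv, hn, Option.getD_none]
    generalize Yv E a g (k + 1) = y
    rcases Nat.lt_or_ge k M with h | h
    · have : M = k + 1 := by omega
      subst this
      generalize Sv E a (k + 1) g k = s
      rw [resp_eq]
      by_cases hc : (s + boolVal y) % 3 = (k + 1) % 3
      · simp only [hc, decide_true]
        have : boolVal true = 1 := rfl
        omega
      · simp only [hc, decide_false]
        have : boolVal false = 0 := rfl
        omega
    · have h' := ih h (fun m h1 h2 => ha m h1 (by omega))
      revert h'
      generalize Sv E a M g k = s
      intro h'
      rw [resp_gt (by omega)]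
      have hy : boolVal y ≤ 1 := by cases y <;> decide
      by_cases hc : s % 3 = (k + 1) % 3
      · simp only [hc, decide_true]
        have : boolVal true = 1 := rfl
        omega
      · simp only [hc, decide_false]
        have : boolVal false = 0 := rfl
        omega

/-- No clause of `H(Ψₙ, Π_t)` avoids the last `⌈t/2⌉` levels. -/
theorem Hset_defined_at_end (n t : ℕ) (ht : 2 ≤ t) (hn : (t + 1) / 2 ≤ n) (a : PA)
    (ha : a ∈ Hset (modQBC n) t) :
    ∃ m, n - (t + 1) / 2 + 1 ≤ m ∧ m ≤ n ∧ (a (2 * m) ≠ none ∨ a (2 * m + 1) ≠ none) := by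
  classical
  by_contra hcon
  push Not at hcon
  obtain ⟨hdom, ⟨P', M'⟩, ⟨⟨hperm, hrel⟩, hmat⟩, hpi, hfalse⟩ := ha
  apply hfalse
  clear hfalse
  simp only at hmat hperm hrel hpi
  subst hmat
  set P := instPrefix (modPrefix n) a with hPdef
  change P.Perm P' at hperm
  change ∀ y ∈ univVars P, ∀ x ∈ existVars P, preceq P y x → preceq P' y x at hrel
  have hsorted : (P.map Prod.snd).Pairwise (· < ·) := instPrefix_sorted n a
  have hndP : (P.map Prod.snd).Nodup := hsorted.imp (fun h => Nat.ne_of_lt h)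
  have hnd : (P'.map Prod.snd).Nodup := (hperm.map Prod.snd).nodup_iff.1 hndP
  set s := (t + 1) / 2 with hs
  -- domain of `a`
  have hdom' : ∀ u, a u ≠ none → u < 2 * (n - s + 1) := by
    intro u hu
    have h1 := hdom u hu
    obtain ⟨⟨q, w⟩, hp, rfl⟩ := List.mem_map.1 h1
    have h2 := (mem_modPrefix n q w).1 hp
    by_contra hc
    have h3 := hcon (w / 2) (by simp only at hc; omega) (by omega)
    rcases Nat.even_or_odd' w with ⟨c, hw | hw⟩
    · apply hu
      have e : 2 * (w / 2) = w := by omega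
      rw [e] at h3
      exact h3.1
    · apply hu
      have e : 2 * (w / 2) + 1 = w := by omega
      rw [e] at h3
      exact h3.2
  -- existential variables
  have hx : ∀ m, 1 ≤ m → m ≤ n → a (2 * m) = none → (Quant.ex, 2 * m) ∈ P := by
    intro m h1 h2 h3
    refine (mem_instPrefix _ _ _ _).2 ⟨h3, Quant.ex, ?_, by simp⟩
    exact (mem_modPrefix _ _ _).2 ⟨by omega, by omega, by simp [mq]⟩
  have hy : ∀ m, n - s + 1 ≤ m → m ≤ n → (Quant.all, 2 * m + 1) ∈ P := by
    intro m h1 h2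
    refine (mem_instPrefix _ _ _ _).2 ⟨(hcon m h1 h2).2, Quant.all, ?_, ?_⟩
    · refine (mem_modPrefix _ _ _).2 ⟨by omega, by omega, ?_⟩
      have : (2 * m + 1) % 2 = 1 := by omega
      simp [mq, this]
    · rw [if_neg]
      rintro ⟨u, hu, hp, -⟩
      have := hdom' u hu
      exact not_preceq_mod (by omega) hp
  -- universal variables
  have hall : ∀ v, (Quant.all, v) ∈ P → v % 2 = 1 := by
    intro v hv
    obtain ⟨-, q', hq', hq⟩ := (mem_instPrefix _ _ _ _).1 hv
    have h2 := (mem_modPrefix _ _ _).1 hq'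
    split_ifs at hq
    rw [← hq] at h2
    have h3 := h2.2.2
    unfold mq at h3
    split_ifs at h3
    omega
  have hvar : ∀ v, 2 ≤ v → v ≤ 2 * n + 1 → a v = none → (Quant.ex, v) ∉ P → (Quant.all, v) ∈ P := by
    intro v h1 h2 h3 h4
    have h5 : ∃ q, (q, v) ∈ P :=
      ⟨_, (mem_instPrefix _ _ _ _).2 ⟨h3, mq v, (mem_modPrefix _ _ _).2 ⟨h1, h2, rfl⟩, rfl⟩⟩
    obtain ⟨q, hq⟩ := h5
    cases q with
    | all => exact hq
    | ex => exact absurd hq h4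
  have hexv : ∀ v, (Quant.ex, v) ∈ P → 2 ≤ v ∧ v ≤ 2 * n + 1 ∧ a v = none := by
    intro v hv
    obtain ⟨h0, q', hq', -⟩ := (mem_instPrefix _ _ _ _).1 hv
    have h2 := (mem_modPrefix _ _ _).1 hq'
    exact ⟨h2.1, h2.2.1, h0⟩
  have hlt : ∀ u v, (Quant.all, u) ∈ P → (Quant.ex, v) ∈ P → u < v → preceq P' u v := by
    intro u v hu hv huv
    exact hrel u ((mem_univVars_iff _ _).2 hu) v ((mem_existVars_iff _ _).2 hv)
      (sorted_preceq hsorted (List.mem_map.2 ⟨_, hu, rfl⟩) (List.mem_map.2 ⟨_, hv, rfl⟩) huv)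
  -- the special level
  have hM : ∃ M, n - s + 1 ≤ M ∧ M ≤ n ∧ preceq P' (2 * M + 1) (2 * M) := by
    by_contra hno
    push Not at hno
    obtain ⟨β, hmono, hβ⟩ := alt_blocks t Quant.all _ hpi
    have key : ∀ r, r < s → ∃ k, P'[k]? = some (Quant.all, 2 * (n - s + 1 + r) + 1) ∧
        2 * (r + 1) ≤ β k := by
      intro r
      induction r with
      | zero =>
        intro hr
        obtain ⟨k, hk⟩ := List.mem_iff_getElem?.1
          (hperm.mem_iff.1 (hy (n - s + 1 + 0) (by omega) (by omega)))
        obtain ⟨j, hj⟩ := List.mem_iff_getElem?.1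
          (hperm.mem_iff.1 (hx (n - s + 1 + 0) (by omega) (by omega)
            (hcon _ (by omega) (by omega)).1))
        have h1 := hno (n - s + 1 + 0) (by omega) (by omega)
        rw [preceq_pos hnd hk hj] at h1
        have hb1 := hβ k Quant.all (by rw [List.getElem?_map, hk]; rfl)
        have hb2 := hβ j Quant.ex (by rw [List.getElem?_map, hj]; rfl)
        have hb3 : β j ≤ β k := hmono (by omega)
        have e1 : β k % 2 = 0 := hb1.2.1 rfl
        have e2 : ¬ β j % 2 = 0 := fun h => by simpa using hb2.2.2 h
        exact ⟨k, hk, by omega⟩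
      | succ r ih =>
        intro hr
        obtain ⟨k0, hk0, hb0⟩ := ih (by omega)
        obtain ⟨k, hk⟩ := List.mem_iff_getElem?.1
          (hperm.mem_iff.1 (hy (n - s + 1 + (r + 1)) (by omega) (by omega)))
        have hxm := hx (n - s + 1 + (r + 1)) (by omega) (by omega)
            (hcon _ (by omega) (by omega)).1
        obtain ⟨j, hj⟩ := List.mem_iff_getElem?.1 (hperm.mem_iff.1 hxm)
        have h1 := hno (n - s + 1 + (r + 1)) (by omega) (by omega)
        rw [preceq_pos hnd hk hj] at h1
        have h2 := hlt _ _ (hy (n - s + 1 + r) (by omega) (by omega)) hxm (by omega)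
        rw [preceq_pos hnd hk0 hj] at h2
        have hb1 := hβ k Quant.all (by rw [List.getElem?_map, hk]; rfl)
        have hb2 := hβ j Quant.ex (by rw [List.getElem?_map, hj]; rfl)
        have hb3 : β j ≤ β k := hmono (by omega)
        have hb4 : β k0 ≤ β j := hmono (by omega)
        have e1 : β k % 2 = 0 := hb1.2.1 rfl
        have e2 : ¬ β j % 2 = 0 := fun h => by simpa using hb2.2.2 h
        exact ⟨k, hk, by omega⟩
    obtain ⟨k, hk, hb⟩ := key (s - 1) (by omega)
    have hb1 := hβ k Quant.all (by rw [List.getElem?_map, hk]; rfl)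
    omega
  obtain ⟨M, hM1, hM2, hM3⟩ := hM
  intro g0
  set E : ℕ → Prop := fun v => (Quant.ex, v) ∈ P with hE
  refine evalQ_of_strat (strat E a M) _ P' g0 hnd ?_ ?_
  · intro P1 x P2 hP g g' hgg
    have hxP : (Quant.ex, x) ∈ P := hperm.mem_iff.2 (by rw [hP]; simp)
    obtain ⟨hx2, hxn, hxa⟩ := hexv x hxP
    have hg : ∀ m, 1 ≤ m → 2 * m + 1 < x ∨ (x = 2 * M ∧ m = M) → ¬ E (2 * m + 1) →
        a (2 * m + 1) = none → g (2 * m + 1) = g' (2 * m + 1) := by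
      intro m hm1 hm2 hm3 hm4
      have hu : (Quant.all, 2 * m + 1) ∈ P := hvar _ (by omega) (by omega) hm4 hm3
      apply hgg
      refine not_mem_tail_of_preceq hnd hP (hperm.mem_iff.1 hu) ?_
      rcases hm2 with h | ⟨rfl, rfl⟩
      · exact hlt _ _ hu hxP h
      · exact hM3
    unfold strat
    split_ifs with hpar
    · have hS : Sv E a M g (x / 2 - 1) = Sv E a M g' (x / 2 - 1) :=
        Sv_congr (fun m h1 h2 => hg m h1 (Or.inl (by omega)))
      rw [hS]
      rcases lt_trichotomy (x / 2) M with h | h | h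
      · rw [resp_lt h, resp_lt h]
      · rw [Yv_congr (hg (x / 2) (by omega) (Or.inr ⟨by omega, h⟩))]
      · rw [resp_gt h, resp_gt h]
    · rfl
  · intro g _ hg
    have hg' : ∀ v, (Quant.ex, v) ∈ P → g v = strat E a M v g :=
      fun v hv => hg v (hperm.mem_iff.1 hv)
    have hsum : ∀ k, k ≤ n → ∑ i ∈ Finset.Icc 1 k,
        (boolVal (override a g (2 * i)) + boolVal (override a g (2 * i + 1))) = Sv E a M g k := by
      intro k
      induction k with
      | zero => intro _; rfl
      | succ k ih =>
        intro hk
        rw [Finset.sum_Icc_succ_top (by omega), ih (by omega)]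
        have h1 : override a g (2 * (k + 1) + 1) = Yv E a g (k + 1) := by
          unfold Yv override
          split_ifs with hE'
          · rw [(hexv _ hE').2.2, Option.getD_none, hg' _ hE']
            unfold strat
            rw [if_neg (by omega)]
          · rfl
        have h2 : override a g (2 * (k + 1)) =
            (a (2 * (k + 1))).getD (resp M (k + 1) (Sv E a M g k) (Yv E a g (k + 1))) := by
          unfold override
          cases hak : a (2 * (k + 1)) with
          | some b => rfl
          | none =>
            rw [Option.getD_none, Option.getD_none, hg' _ (hx _ (by omega) hk hak)]
            unfold strat
            have e : 2 * (k + 1) / 2 = k + 1 := by omega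
            rw [if_pos (by omega), e]
            rfl
        rw [h1, h2]
        rfl
    change modMatrix n 0 (override a g)
    unfold modMatrix
    rw [hsum n le_rfl, Nat.zero_add]
    exact Sv_ne (by omega) hM2 (fun m h1 h2 => (hcon m (by omega) h2).1)

/-- Lemma 7.3: for `t ≥ 2` and `n ≥ ⌈t/2⌉`, in any
QU-resolution falsity proof of `Ψₙ` from `H(Ψₙ, Π_t)`, the label of every
sink of `G(π)` is defined on one of the variables
`x_{n−⌈t/2⌉+1}, y_{n−⌈t/2⌉+1}, …, xₙ, yₙ` (recall `xₘ = 2m`, `yₘ = 2m+1`). -/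
theorem mod3_sink_defined_at_end (n t : ℕ) (ht : 2 ≤ t)
    (hn : (t + 1) / 2 ≤ n) (L : List QUStep)
    (hL : IsFalsityProof (modQBC n) (Hset (modQBC n) t) L) :
    ∀ i a, isSink L i → stepClause? L i = some a →
      ∃ m, n - (t + 1) / 2 + 1 ≤ m ∧ m ≤ n ∧
        (a (2 * m) ≠ none ∨ a (2 * m + 1) ≠ none) := by
  intro i a hsink hcl
  obtain ⟨hi, hedge⟩ := hsink
  have hv := hL.1 i
  unfold validStep at hv
  unfold edge at hedge
  unfold stepClause? at hcl
  rw [List.getElem?_eq_getElem hi] at hv hedge hcl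
  cases hstep : L[i] with
  | ax C =>
    simp only [hstep] at hv hcl
    have : C = a := by simpa [QUStep.clause] using hcl
    subst this
    exact Hset_defined_at_end n t ht hn C hv
  | elim C j =>
    simp only [hstep] at hedge
    exact absurd rfl (hedge j)
  | res C j k v =>
    simp only [hstep] at hedge
    exact absurd (Or.inl rfl) (hedge j)
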